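/- Fix an index i and let h_i(c_i) = lim_{z→c_i} (1/R'(z) − b_i/(z − c_i)) (this limit exists, since z ↦ 1/R'(z) − b_i/(z − c_i) extends holomorphically across c_i). Then for every z ∈ ℂ that is not a critical value of R and with z ∉ {d_1, …, d_{2d−2}}, one has Σ_{y ∈ ℂ, R(y)=z} 1/((y − c_i)·(R'(y))²) = h_i(c_i)/(z − d_i) + Σ_{j ≠ i} b_j/((c_j − c_i)·(z − d_j)), where the fiber sum on the left converges (the singular contributions of the two preimages near c_i cancel). -/

import Mathlib

open MeasureTheory Polynomial Filter Topology

noncomputable section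

/-- The rational map `R = p/q` as a function on `ℂ`. -/
def Rfun (p q : Polynomial ℂ) : ℂ → ℂ := fun z => p.eval z / q.eval z

/-- `z ∈ ℂ` is a critical value of `R = p/q`. -/
def IsCritValue (p q : Polynomial ℂ) (z : ℂ) : Prop :=
  ∃ c : ℂ, q.eval c ≠ 0 ∧ deriv (Rfun p q) c = 0 ∧ Rfun p q c = z

/-- The Ruelle (transfer) operator: `(R*φ)(z) = ∑_{R(y) = z} φ(y)/(R'(y))²`,
the sum being over the fiber of `R = p/q` over `z`. -/
def ruelleOp (p q : Polynomial ℂ) (φ : ℂ → ℂ) : ℂ → ℂ := fun z =>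
  ∑' y : {y : ℂ // q.eval y ≠ 0 ∧ Rfun p q y = z},
    φ (y : ℂ) / (deriv (Rfun p q) (y : ℂ)) ^ 2

/-- `(Rⁿ)'(a) = ∏_{j<n} R'(Rʲ(a))`. -/
def derivIter (p q : Polynomial ℂ) (n : ℕ) (a : ℂ) : ℂ :=
  ∏ j ∈ Finset.range n, deriv (Rfun p q) ((Rfun p q)^[j] a)

/-- `γ_a(z) = a(a-1)/(z(z-1)(z-a))`. -/
def gam (a z : ℂ) : ℂ := a * (a - 1) / (z * (z - 1) * (z - a))

theorem eq_C_leadingCoeff_mul_nodal {P : ℂ[X]} (hP : P ≠ 0) (s : Finset ℂ)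
    (hs : ∀ r ∈ s, P.eval r = 0) (hd : P.natDegree ≤ s.card) :
    P = C P.leadingCoeff * Lagrange.nodal s id := by
  refine eq_leadingCoeff_mul_of_monic_of_dvd_of_natDegree_le Lagrange.nodal_monic ?_
    (by rwa [Lagrange.natDegree_nodal])
  have h := (Multiset.prod_X_sub_C_dvd_iff_le_roots hP s.val).2
    ((Multiset.le_iff_subset s.nodup).2 fun r hr => (mem_roots hP).2 (hs r hr))
  rw [Lagrange.nodal_eq]
  exact h

/-- Derivative of the partial fraction expansion of `G / Q` when `Q` has simple roots. -/
theorem hasDerivAt_eval_div_eval {G Q : ℂ[X]} (s : Finset ℂ) (hQ0 : Q ≠ 0)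
    (hs : ∀ r ∈ s, Q.eval r = 0) (hQ : Q.natDegree ≤ s.card) (hG : G.natDegree ≤ s.card)
    {c : ℂ} (hc : c ∉ s) :
    HasDerivAt (fun w => G.eval w / Q.eval w)
      (-∑ r ∈ s, G.eval r / ((r - c) ^ 2 * Q.derivative.eval r)) c := by
  classical
  set k := Q.leadingCoeff with hk
  have hk0 : k ≠ 0 := leadingCoeff_ne_zero.2 hQ0
  have hQe : Q = C k * Lagrange.nodal s id := eq_C_leadingCoeff_mul_nodal hQ0 s hs hQ
  set a := G.coeff s.card
  have hinj : Set.InjOn (id : ℂ → ℂ) s := Function.injective_id.injOn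
  have hdeg : (G - C a * Lagrange.nodal s id).degree < s.card := by
    rw [degree_lt_iff_coeff_zero]
    intro m hm
    rcases hm.eq_or_lt with rfl | hm
    · have : (Lagrange.nodal s (id : ℂ → ℂ)).coeff s.card = 1 := by
        have := (Lagrange.nodal_monic (s := s) (v := (id : ℂ → ℂ))).coeff_natDegree
        rwa [Lagrange.natDegree_nodal] at this
      simp [this, a]
    · rw [coeff_sub, coeff_C_mul, coeff_eq_zero_of_natDegree_lt (hG.trans_lt hm),
        coeff_eq_zero_of_natDegree_lt (by rwa [Lagrange.natDegree_nodal])]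
      simp
  have hGe := Lagrange.eq_interpolate hinj hdeg
  have hexp : ∀ w ∉ s, G.eval w / Q.eval w =
      a / k + ∑ r ∈ s, G.eval r / Q.derivative.eval r * (w - r)⁻¹ := by
    intro w hw
    have hw' : ∀ r ∈ s, w ≠ id r := fun r hr h => hw (h ▸ hr)
    have hn := Lagrange.eval_nodal_not_at_node hw'
    have h1 := congrArg (eval w) hGe
    rw [Lagrange.eval_interpolate_not_at_node _ hw'] at h1
    have h2 : G.eval w = eval w (Lagrange.nodal s id) * (a +
        ∑ r ∈ s, Lagrange.nodalWeight s id r * (w - id r)⁻¹ *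
          eval (id r) (G - C a * Lagrange.nodal s id)) := by
      rw [mul_add, ← h1]; simp; ring
    have h3 : Q.eval w = k * eval w (Lagrange.nodal s id) := by rw [hQe]; simp
    rw [h2, h3, mul_comm k, mul_div_mul_left _ _ hn, add_div, Finset.sum_div]
    congr 1
    refine Finset.sum_congr rfl fun r hr => ?_
    have h4 : Q.derivative.eval r = k * (Lagrange.nodal s id).derivative.eval r := by
      rw [hQe]; simp
    have h5 := Lagrange.nodalWeight_eq_eval_derivative_nodal (v := (id : ℂ → ℂ)) hr
    have h6 := Lagrange.eval_nodal_at_node (v := (id : ℂ → ℂ)) hr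
    simp only [id] at h5 h6 ⊢
    rw [h4, h5, eval_sub, eval_mul, h6]
    simp only [mul_zero, sub_zero, div_eq_mul_inv, mul_inv]
    ring
  have hev : (fun w => G.eval w / Q.eval w) =ᶠ[𝓝 c]
      fun w => a / k + ∑ r ∈ s, G.eval r / Q.derivative.eval r * (w - r)⁻¹ := by
    filter_upwards [s.finite_toSet.isClosed.isOpen_compl.mem_nhds (by simpa using hc)] with w hw
    exact hexp w (by simpa using hw)
  refine HasDerivAt.congr_of_eventuallyEq ?_ hev
  have hd : ∀ r ∈ s, HasDerivAt (fun w : ℂ => G.eval r / Q.derivative.eval r * (w - r)⁻¹)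
      (G.eval r / Q.derivative.eval r * (-1 / (c - r) ^ 2)) c := fun r hr =>
    (((hasDerivAt_id c).sub_const r).inv
      (sub_ne_zero.2 fun h => hc (by simpa [← h] using hr))).const_mul _
  refine ((HasDerivAt.fun_sum hd).const_add _).congr_deriv ?_
  rw [← Finset.sum_neg_distrib]
  refine Finset.sum_congr rfl fun r _ => ?_
  rw [← neg_sub r c, neg_sq]
  simp only [div_eq_mul_inv, mul_inv]
  ring

/-- The numerator of the derivative of `p / q`. -/
def wronsk (p q : ℂ[X]) : ℂ[X] := derivative p * q - p * derivative q

theorem hasDerivAt_Rfun (p q : ℂ[X]) {w : ℂ} (hw : q.eval w ≠ 0) :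
    HasDerivAt (Rfun p q) ((wronsk p q).eval w / q.eval w ^ 2) w := by
  exact ((p.hasDerivAt w).fun_div (q.hasDerivAt w) hw).congr_deriv (by simp [wronsk])

theorem eventually_eval_ne_zero {q : ℂ[X]} {w : ℂ} (hw : q.eval w ≠ 0) :
    ∀ᶠ x in 𝓝 w, q.eval x ≠ 0 :=
  q.continuous.continuousAt.eventually_ne hw

theorem deriv_deriv_Rfun {p q : ℂ[X]} {w : ℂ} (hw : q.eval w ≠ 0)
    (h : (wronsk p q).eval w = 0) :
    deriv (deriv (Rfun p q)) w = (wronsk p q).derivative.eval w / q.eval w ^ 2 := by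
  have hev : deriv (Rfun p q) =ᶠ[𝓝 w] fun x => (wronsk p q).eval x / q.eval x ^ 2 := by
    filter_upwards [eventually_eval_ne_zero hw] with x hx using (hasDerivAt_Rfun p q hx).deriv
  rw [hev.deriv_eq, (((wronsk p q).hasDerivAt w).fun_div ((q.hasDerivAt w).fun_pow 2)
    (pow_ne_zero 2 hw)).deriv, h]
  field_simp
  simp

theorem ruelle_of_tau_at_critical_point (d : ℕ) (hd : 2 ≤ d) (p q : Polynomial ℂ) (hcop : IsCoprime p q)
    (hdp : p.natDegree = d) (hdq : q.natDegree = d - 1)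
    (c : Fin (2 * d - 2) → ℂ) (hcinj : Function.Injective c)
    (hcq : ∀ i, q.eval (c i) ≠ 0)
    (hcderiv : ∀ i, deriv (Rfun p q) (c i) = 0)
    (hcsimple : ∀ i, deriv (deriv (Rfun p q)) (c i) ≠ 0)
    (hcall : ∀ z : ℂ, q.eval z ≠ 0 → deriv (Rfun p q) z = 0 → ∃ i, c i = z)
    (i : Fin (2 * d - 2)) :
    ∃ L : ℂ,
      Tendsto (fun w : ℂ => 1 / deriv (Rfun p q) w -
          (1 / deriv (deriv (Rfun p q)) (c i)) / (w - c i)) (𝓝[≠] (c i)) (𝓝 L) ∧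
      ∀ z : ℂ, ¬ IsCritValue p q z → (∀ j, z ≠ Rfun p q (c j)) →
        (∑' y : {y : ℂ // q.eval y ≠ 0 ∧ Rfun p q y = z},
            1 / (((y : ℂ) - c i) * (deriv (Rfun p q) (y : ℂ)) ^ 2)) =
          L / (z - Rfun p q (c i)) +
            ∑ j ∈ Finset.univ.erase i,
              (1 / deriv (deriv (Rfun p q)) (c j)) /
                ((c j - c i) * (z - Rfun p q (c j))) := by
  classical
  set W := wronsk p q with hWdef
  have hW0 : ∀ j, W.eval (c j) = 0 := fun j => by
    have := hcderiv j
    rw [(hasDerivAt_Rfun p q (hcq j)).deriv, div_eq_zero_iff] at this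
    exact this.resolve_right (pow_ne_zero 2 (hcq j))
  have hR2 : ∀ j, deriv (deriv (Rfun p q)) (c j) = W.derivative.eval (c j) / q.eval (c j) ^ 2 :=
    fun j => deriv_deriv_Rfun (hcq j) (hW0 j)
  have hWd : ∀ j, W.derivative.eval (c j) ≠ 0 := fun j h => hcsimple j (by rw [hR2, h, zero_div])
  have hWne : W ≠ 0 := fun h => hWd i (by simp [h])
  have hWdeg : W.natDegree ≤ 2 * d - 2 := by
    refine (natDegree_sub_le _ _).trans (max_le ?_ ?_)
    · have h1 := natDegree_mul_le (p := derivative p) (q := q)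
      have h2 := natDegree_derivative_le p
      omega
    · have h1 := natDegree_mul_le (p := p) (q := derivative q)
      have h2 := natDegree_derivative_le q
      omega
  obtain ⟨V, hV⟩ := dvd_iff_isRoot.2 (show W.IsRoot (c i) from hW0 i)
  have hVne : V ≠ 0 := fun h => hWne (by rw [hV, h, mul_zero])
  have hVdeg : V.natDegree + 1 ≤ 2 * d - 2 := by
    rw [hV, natDegree_mul (X_sub_C_ne_zero _) hVne, natDegree_X_sub_C] at hWdeg
    omega
  have hWev : ∀ w, W.eval w = (w - c i) * V.eval w := fun w => by rw [hV]; simp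
  have hWdev : ∀ w, W.derivative.eval w = V.eval w + (w - c i) * V.derivative.eval w :=
    fun w => by rw [hV]; simp
  have hVi : V.eval (c i) = W.derivative.eval (c i) := by rw [hWdev]; simp
  have hVi0 : V.eval (c i) ≠ 0 := hVi ▸ hWd i
  have hVj : ∀ j, j ≠ i → V.eval (c j) = 0 := fun j hj => by
    have h := hW0 j
    rw [hWev] at h
    exact (mul_eq_zero.1 h).resolve_left (sub_ne_zero.2 (hcinj.ne hj))
  set u : ℂ → ℂ := fun w => q.eval w ^ 2 / V.eval w with hu
  have hud : HasDerivAt u (deriv u (c i)) (c i) :=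
    (((q.differentiable _).pow 2).div (V.differentiable _) hVi0).hasDerivAt
  refine ⟨deriv u (c i), ?_, ?_⟩
  · refine (hasDerivAt_iff_tendsto_slope.1 hud).congr' ?_
    filter_upwards [self_mem_nhdsWithin, (eventually_eval_ne_zero (hcq i)).filter_mono
      nhdsWithin_le_nhds, (eventually_eval_ne_zero hVi0).filter_mono nhdsWithin_le_nhds]
      with w hw hqw hVw
    have hw' : w - c i ≠ 0 := sub_ne_zero.2 hw
    have hqi := hcq i
    rw [(hasDerivAt_Rfun p q hqw).deriv, hR2, ← hVi, ← hWdef, hWev, slope_def_field]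
    simp only [hu]
    field_simp
  intro z hz hzc
  set F : ℂ[X] := p - C z * q with hF
  have hFev : ∀ w, F.eval w = p.eval w - z * q.eval w := fun w => by simp [hF]
  have hFdeg : F.natDegree = d := by
    rw [hF, natDegree_sub_eq_left_of_natDegree_lt, hdp]
    exact (natDegree_C_mul_le _ _).trans_lt (by omega)
  have hFne : F ≠ 0 := fun h => by rw [h, natDegree_zero] at hFdeg; omega
  have hFdev : ∀ w, F.derivative.eval w = p.derivative.eval w - z * q.derivative.eval w :=
    fun w => by simp [hF]
  have hFq : ∀ w, F.eval w = 0 → q.eval w ≠ 0 := by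
    intro w hw hq
    obtain ⟨a, b, hab⟩ := hcop
    have hp : p.eval w = 0 := by simpa [hFev, hq] using hw
    simpa [hp, hq] using congrArg (eval w) hab
  have hfib : ∀ w, (q.eval w ≠ 0 ∧ Rfun p q w = z) ↔ F.eval w = 0 := by
    intro w
    constructor
    · rintro ⟨hq, h⟩
      rw [Rfun, div_eq_iff hq] at h
      rw [hFev, h, sub_self]
    · intro h
      refine ⟨hFq w h, ?_⟩
      rw [Rfun, div_eq_iff (hFq w h)]
      rw [hFev] at h
      linear_combination h
  have hWF : ∀ w, F.eval w = 0 → W.eval w = F.derivative.eval w * q.eval w := by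
    intro w h
    rw [hFev] at h
    rw [hFdev, hWdef, wronsk]
    simp only [eval_sub, eval_mul]
    linear_combination (-q.derivative.eval w) * h
  have hWy : ∀ w, F.eval w = 0 → W.eval w ≠ 0 := by
    intro w h hw
    have hq := (hfib w).2 h
    exact hz ⟨w, hq.1, by rw [(hasDerivAt_Rfun p q hq.1).deriv, ← hWdef, hw, zero_div], hq.2⟩
  have hFy : ∀ w, F.eval w = 0 → F.derivative.eval w ≠ 0 := fun w h h' =>
    hWy w h (by rw [hWF w h, h', zero_mul])
  have hFc : ∀ j, F.eval (c j) ≠ 0 := fun j h => hWy _ h (hW0 j)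
  have hnodup : F.roots.Nodup := by
    rw [Multiset.nodup_iff_count_le_one]
    intro r
    rw [count_roots]
    by_contra! h
    obtain ⟨h1, h2⟩ := (one_lt_rootMultiplicity_iff_isRoot hFne).1 h
    exact hFy r h1 h2
  set A := F.roots.toFinset with hA
  have hmemA : ∀ w, w ∈ A ↔ F.eval w = 0 := fun w => by
    rw [hA, Multiset.mem_toFinset, mem_roots hFne, IsRoot.def]
  have hAcard : A.card = d := by
    rw [hA, Multiset.toFinset_card_of_nodup hnodup, IsAlgClosed.card_roots_eq_natDegree, hFdeg]
  set B := (Finset.univ.erase i).image c with hB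
  have hBcard : B.card = 2 * d - 2 - 1 := by
    rw [hB, Finset.card_image_of_injective _ hcinj, Finset.card_erase_of_mem (Finset.mem_univ _),
      Finset.card_univ, Fintype.card_fin]
  have hmemB : ∀ w ∈ B, ∃ j, j ≠ i ∧ c j = w := fun w hw => by simpa [hB] using hw
  have hdisj : Disjoint A B := by
    rw [Finset.disjoint_left]
    intro w hwA hwB
    obtain ⟨j, -, rfl⟩ := hmemB w hwB
    exact hFc j ((hmemA _).1 hwA)
  have hcard : (A ∪ B).card = d + (2 * d - 2 - 1) := by
    rw [Finset.card_union_of_disjoint hdisj, hAcard, hBcard]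
  have hci : c i ∉ A ∪ B := by
    rw [Finset.mem_union, hmemA]
    rintro (h | h)
    · exact hFc i h
    · obtain ⟨j, hj, h⟩ := hmemB _ h
      exact hj (hcinj h)
  have hmain := hasDerivAt_eval_div_eval (G := q ^ 3) (Q := V * F) (A ∪ B) (mul_ne_zero hVne hFne)
    (fun r hr => by
      rw [eval_mul]
      rcases Finset.mem_union.1 hr with h | h
      · rw [(hmemA r).1 h, mul_zero]
      · obtain ⟨j, hj, rfl⟩ := hmemB r h
        rw [hVj j hj, zero_mul])
    (by rw [natDegree_mul hVne hFne, hcard, hFdeg]; omega)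
    (by
      have := natDegree_pow_le (p := q) (n := 3)
      rw [hcard]; omega) hci
  have hdirect : HasDerivAt (fun w => (q ^ 3).eval w / (V * F).eval w)
      (deriv u (c i) * (q.eval (c i) / F.eval (c i))) (c i) := by
    have h1 := hud.fun_mul ((q.hasDerivAt (c i)).fun_div (F.hasDerivAt (c i)) (hFc i))
    have h2 : q.derivative.eval (c i) * F.eval (c i) - q.eval (c i) * F.derivative.eval (c i) = 0 := by
      have h := hW0 i
      rw [hWdef, wronsk] at h
      simp only [eval_sub, eval_mul] at h
      rw [hFev, hFdev]
      linear_combination -h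
    rw [h2, zero_div, mul_zero, add_zero] at h1
    refine h1.congr_of_eventuallyEq (Eventually.of_forall fun w => ?_)
    simp only [hu, eval_mul, eval_pow, div_mul_div_comm]
    ring
  have hkey := hmain.unique hdirect
  have hdz : ∀ j, q.eval (c j) / F.eval (c j) = -1 / (z - Rfun p q (c j)) := by
    intro j
    have h1 := sub_ne_zero.2 (hzc j)
    rw [div_eq_div_iff (hFc j) h1, hFev, Rfun]
    have := hcq j
    field_simp
    ring
  have hts : (∑' y : {y : ℂ // q.eval y ≠ 0 ∧ Rfun p q y = z},
      1 / (((y : ℂ) - c i) * (deriv (Rfun p q) (y : ℂ)) ^ 2)) =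
      ∑ y ∈ A, 1 / ((y - c i) * (deriv (Rfun p q) y) ^ 2) := by
    rw [← Finset.tsum_subtype]
    exact (Equiv.subtypeEquivRight fun w => (hfib w).trans (hmemA w).symm).tsum_eq
      (fun y : {y // y ∈ A} => 1 / (((y : ℂ) - c i) * (deriv (Rfun p q) (y : ℂ)) ^ 2))
  rw [hts]
  rw [Finset.sum_union hdisj, hdz] at hkey
  have hSA : ∑ r ∈ A, (q ^ 3).eval r / ((r - c i) ^ 2 * (V * F).derivative.eval r) =
      ∑ y ∈ A, 1 / ((y - c i) * (deriv (Rfun p q) y) ^ 2) := by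
    refine Finset.sum_congr rfl fun y hy => ?_
    have hy := (hmemA y).1 hy
    have hq := hFq y hy
    have hWy' := hWy y hy
    have hF' := hFy y hy
    have hWF' := hWF y hy
    rw [hWev] at hWy' hWF'
    have h1 := left_ne_zero_of_mul hWy'
    have h2 := right_ne_zero_of_mul hWy'
    rw [(hasDerivAt_Rfun p q hq).deriv, ← hWdef, hWev]
    simp only [derivative_mul, eval_add, eval_mul, eval_pow, hy, mul_zero, zero_add]
    field_simp
    linear_combination hWF'
  have hSB : ∑ r ∈ B, (q ^ 3).eval r / ((r - c i) ^ 2 * (V * F).derivative.eval r) =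
      -∑ j ∈ Finset.univ.erase i, (1 / deriv (deriv (Rfun p q)) (c j)) /
                ((c j - c i) * (z - Rfun p q (c j))) := by
    rw [hB, Finset.sum_image hcinj.injOn, ← Finset.sum_neg_distrib]
    refine Finset.sum_congr rfl fun j hj => ?_
    have hj := Finset.ne_of_mem_erase hj
    have h1 := sub_ne_zero.2 (hcinj.ne hj)
    have h2 := hWd j
    have h3 := hcq j
    have h4 := hdz j
    have h5 := hFc j
    rw [hWdev, hVj j hj, zero_add] at h2
    have h6 := right_ne_zero_of_mul h2
    rw [hR2, hWdev, hVj j hj]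
    simp only [derivative_mul, eval_add, eval_mul, eval_pow, hVj j hj, zero_mul, zero_add, add_zero]
    calc _ = q.eval (c j) ^ 2 / ((c j - c i) ^ 2 * V.derivative.eval (c j)) *
          (q.eval (c j) / F.eval (c j)) := by field_simp
      _ = _ := by
        rw [h4]
        have := sub_ne_zero.2 (hzc j)
        field_simp
  rw [hSA, hSB] at hkey
  linear_combination -hkey

end
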